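/- For every integer n ≥ 4, the commutator subgroup of the double cover S̃_n equals Ã_n; that is, ⁅⊤, ⊤⁆ = π⁻¹(alternatingGroup (Fin n)) as subgroups of S̃_n. -/

import Mathlib

/-- Relations defining the double cover `S̃ₙ` of the symmetric group:
generators are `none = z` and `some i = tᵢ` for `i : Fin (n-1)`, with relations
`z² = 1`, `tᵢ² = z`, `(tᵢ tᵢ₊₁)³ = z` and `(tᵢ tⱼ)² = z` for `|i - j| ≥ 2`. -/
def spinRels (n : ℕ) : Set (FreeGroup (Option (Fin (n - 1)))) :=
  {r | r = FreeGroup.of (none : Option (Fin (n - 1))) ^ 2}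
  ∪ {r | ∃ i : Fin (n - 1), r = FreeGroup.of (some i) ^ 2 * (FreeGroup.of none)⁻¹}
  ∪ {r | ∃ i j : Fin (n - 1), (j : ℕ) = (i : ℕ) + 1 ∧
      r = (FreeGroup.of (some i) * FreeGroup.of (some j)) ^ 3 * (FreeGroup.of none)⁻¹}
  ∪ {r | ∃ i j : Fin (n - 1), ((i : ℕ) + 2 ≤ (j : ℕ) ∨ (j : ℕ) + 2 ≤ (i : ℕ)) ∧
      r = (FreeGroup.of (some i) * FreeGroup.of (some j)) ^ 2 * (FreeGroup.of none)⁻¹}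

/-- The double cover `S̃ₙ` of the symmetric group, as a presented group. -/
abbrev SpinSym (n : ℕ) : Type := PresentedGroup (spinRels n)

/-- The central element `z` of `S̃ₙ`. -/
def spinZ (n : ℕ) : SpinSym n := PresentedGroup.of none

/-- The generator `tᵢ` of `S̃ₙ`. -/
def spinT (n : ℕ) (i : Fin (n - 1)) : SpinSym n := PresentedGroup.of (some i)

/-- The `i`-th point of `Fin n`, for `i : Fin (n-1)`. -/
def finL {n : ℕ} (i : Fin (n - 1)) : Fin n := ⟨(i : ℕ), by have := i.2; omega⟩

/-- The `(i+1)`-st point of `Fin n`, for `i : Fin (n-1)`. -/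
def finR {n : ℕ} (i : Fin (n - 1)) : Fin n := ⟨(i : ℕ) + 1, by have := i.2; omega⟩

/-- `π : S̃ₙ → Sₙ` is the canonical projection iff `π z = 1` and `π tᵢ` is the
transposition of the `i`-th and `(i+1)`-st points. -/
def IsSpinProj (n : ℕ) (π : SpinSym n →* Equiv.Perm (Fin n)) : Prop :=
  π (spinZ n) = 1 ∧ ∀ i : Fin (n - 1), π (spinT n i) = Equiv.swap (finL i) (finR i)

/-- The double cover `Ãₙ = π⁻¹(Aₙ)` of the alternating group, as a subgroup of `S̃ₙ`. -/
def SpinAlt (n : ℕ) (π : SpinSym n →* Equiv.Perm (Fin n)) : Subgroup (SpinSym n) :=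
  (alternatingGroup (Fin n)).comap π

/-- The central element `z`, as an element of `Ãₙ`. -/
def spinZA (n : ℕ) (π : SpinSym n →* Equiv.Perm (Fin n)) (hπ : IsSpinProj n π) :
    ↥(SpinAlt n π) :=
  ⟨spinZ n, Subgroup.mem_comap.mpr (by rw [hπ.1]; exact Subgroup.one_mem _)⟩

theorem spinZ_sq (n : ℕ) : spinZ n ^ 2 = 1 :=
  PresentedGroup.one_of_mem (rels := spinRels n) (Or.inl (Or.inl (Or.inl rfl)))

theorem spinT_sq {n : ℕ} (i : Fin (n - 1)) : spinT n i ^ 2 = spinZ n :=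
  mul_inv_eq_one.mp <|
    PresentedGroup.one_of_mem (rels := spinRels n) (Or.inl (Or.inl (Or.inr ⟨i, rfl⟩)))

theorem spinT_mul_cube {n : ℕ} (i j : Fin (n - 1)) (h : (j : ℕ) = (i : ℕ) + 1) :
    (spinT n i * spinT n j) ^ 3 = spinZ n :=
  mul_inv_eq_one.mp <|
    PresentedGroup.one_of_mem (rels := spinRels n) (Or.inl (Or.inr ⟨i, j, h, rfl⟩))

theorem spinT_mul_sq_of_apart {n : ℕ} (i j : Fin (n - 1))
    (h : (i : ℕ) + 2 ≤ (j : ℕ) ∨ (j : ℕ) + 2 ≤ (i : ℕ)) :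
    (spinT n i * spinT n j) ^ 2 = spinZ n :=
  mul_inv_eq_one.mp <|
    PresentedGroup.one_of_mem (rels := spinRels n) (Or.inr ⟨i, j, h, rfl⟩)

/-- For `n ≥ 4`, every homomorphism from `S̃ₙ` to a commutative group kills `z`. -/
theorem map_spinZ_eq_one {n : ℕ} (hn : 4 ≤ n) {A : Type*} [CommGroup A] (f : SpinSym n →* A) :
    f (spinZ n) = 1 := by
  have h₀ := congrArg f (spinT_sq (n := n) ⟨0, by omega⟩)
  have h₂ := congrArg f (spinT_sq (n := n) ⟨2, by omega⟩)
  have h := congrArg f (spinT_mul_sq_of_apart (n := n) ⟨0, by omega⟩ ⟨2, by omega⟩ (by simp))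
  have hz := congrArg f (spinZ_sq n)
  simp only [map_mul, map_pow, map_one] at h₀ h₂ h hz
  rw [← h, mul_pow, h₀, h₂, ← sq, hz]

/-- For `n ≥ 4`, a homomorphism from `S̃ₙ` to a commutative group agrees on all the `tᵢ`. -/
theorem map_spinT_eq {n : ℕ} (hn : 4 ≤ n) {A : Type*} [CommGroup A] (f : SpinSym n →* A)
    (i : Fin (n - 1)) : f (spinT n i) = f (spinT n ⟨0, by omega⟩) := by
  have hsq (j : Fin (n - 1)) : f (spinT n j) ^ 2 = 1 := by
    rw [← map_pow, spinT_sq, map_spinZ_eq_one hn]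
  obtain ⟨k, hk⟩ := i
  induction k with
  | zero => rfl
  | succ k ih =>
    rw [← ih (by omega)]
    have h := congrArg f (spinT_mul_cube (n := n) ⟨k, by omega⟩ ⟨k + 1, hk⟩ rfl)
    rw [map_pow, map_mul, map_spinZ_eq_one hn, pow_succ, mul_pow, hsq, hsq, one_mul, one_mul] at h
    have h' := hsq ⟨k, by omega⟩
    rw [sq] at h'
    exact mul_left_cancel (h.trans h'.symm)

/-- For `n ≥ 4`, a homomorphism from `S̃ₙ` to a commutative group is determined by the sign. -/
theorem map_eq_of_sign {n : ℕ} (hn : 4 ≤ n) {π : SpinSym n →* Equiv.Perm (Fin n)}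
    (hπ : IsSpinProj n π) {A : Type*} [CommGroup A] (f : SpinSym n →* A) (x : SpinSym n) :
    (Equiv.Perm.sign (π x) = 1 ∧ f x = 1) ∨
      (Equiv.Perm.sign (π x) = -1 ∧ f x = f (spinT n ⟨0, by omega⟩)) := by
  have hsq : f (spinT n ⟨0, by omega⟩) * f (spinT n ⟨0, by omega⟩) = 1 := by
    rw [← sq, ← map_pow, spinT_sq, map_spinZ_eq_one hn]
  have hx : x ∈ Subgroup.closure (Set.range (PresentedGroup.of (rels := spinRels n))) := by
    rw [PresentedGroup.closure_range_of]
    trivial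
  induction hx using Subgroup.closure_induction with
  | mem x hx =>
    obtain ⟨_ | i, rfl⟩ := hx
    · refine Or.inl ⟨?_, map_spinZ_eq_one hn f⟩
      change Equiv.Perm.sign (π (spinZ n)) = 1
      rw [hπ.1, map_one]
    · refine Or.inr ⟨?_, map_spinT_eq hn f i⟩
      change Equiv.Perm.sign (π (spinT n i)) = -1
      rw [hπ.2, Equiv.Perm.sign_swap]
      simp [finL, finR]
  | one => simp
  | mul x y _ _ hx hy =>
    simp only [map_mul]
    rcases hx with ⟨hx, hx'⟩ | ⟨hx, hx'⟩ <;> rcases hy with ⟨hy, hy'⟩ | ⟨hy, hy'⟩ <;>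
      simp [hx, hx', hy, hy', hsq]
  | inv x _ hx =>
    simp only [map_inv]
    rcases hx with ⟨hx, hx'⟩ | ⟨hx, hx'⟩
    · simp [hx, hx']
    · exact Or.inr ⟨by simp [hx], by rw [hx', inv_eq_of_mul_eq_one_left hsq]⟩

/-- For `n ≥ 4`, the commutator subgroup of `S̃ₙ` equals `Ãₙ = π⁻¹(Aₙ)`. -/
theorem commutator_spinSym_eq_spinAlt (n : ℕ) (hn : 4 ≤ n)
    (π : SpinSym n →* Equiv.Perm (Fin n)) (hπ : IsSpinProj n π) :
    commutator (SpinSym n) = SpinAlt n π := by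
  apply le_antisymm
  · have h := Abelianization.commutator_subset_ker (Equiv.Perm.sign.comp π)
    intro x hx
    simpa [SpinAlt] using h hx
  · intro x hx
    have hx : Equiv.Perm.sign (π x) = 1 := by simpa [SpinAlt] using hx
    rw [← Abelianization.ker_of, MonoidHom.mem_ker]
    rcases map_eq_of_sign hn hπ Abelianization.of x with h | h
    · exact h.2
    · simp [hx] at h
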